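/- arXiv:1404.7455 — 2 statements merged into one kernel-verified Lean document; each statement's English description precedes it below -/
import Mathlib

section
/- Let 0 = a₀ < a₁ < ⋯ < a_m = 1 be a partition of [0,1] with intervals I_j = [a_{j−1}, a_j], and let τ1, τ2 : [0,1] → [0,1] satisfy: τ1(x) ≤ τ2(x) for all x; on each I_j both τ1 and τ2 restrict to C¹ functions that are strictly monotone with the same orientation (both increasing or both decreasing). Suppose τ_k preserves a Borel probability measure μ_k on [0,1] whose distribution function F_k(x) = μ_k([0,x]) is continuous, for k = 1,2. Then for every λ ∈ (0,1) there exists a Borel measurable map 𝝉 : [0,1] → [0,1] such that (i) τ1(x) ≤ 𝝉(x) ≤ τ2(x) for all x ∈ [0,1], (ii) 𝝉 is monotone on each partition interval I_j, and (iii) 𝝉 preserves the measure μ = λ·μ1 + (1−λ)·μ2, whose distribution function is F = λ·F1 + (1−λ)·F2. -/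
open MeasureTheory Set Filter
open scoped ENNReal


lemma aux_rightCont (ν : Measure ℝ) [IsFiniteMeasure ν] (y : ℝ) :
    Tendsto (fun r => ν (Iic r)) (nhdsWithin y (Ioi y)) (nhds (ν (Iic y))) := by
  have h := tendsto_measure_biInter_gt (μ := ν) (s := fun r : ℝ => Iic r) (a := y)
    (fun r _ => measurableSet_Iic.nullMeasurableSet)
    (fun i j _ hij => Iic_subset_Iic.2 hij) ⟨y + 1, by simp, measure_ne_top _ _⟩
  have e : (⋂ r > y, Iic r) = Iic y := by
    ext z
    simp only [mem_iInter, mem_Iic]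
    exact ⟨fun h => le_of_forall_gt_imp_ge_of_dense h, fun h r hr => h.trans hr.le⟩
  rw [e] at h
  exact h

lemma aux_leftCont (ν : Measure ℝ) [IsFiniteMeasure ν] [NullSingletonClass ν] (y : ℝ) :
    Tendsto (fun r => ν (Iic r)) (nhdsWithin y (Iio y)) (nhds (ν (Iic y))) := by
  have h := tendsto_measure_biInter_gt (μ := ν) (ι := ℝᵒᵈ)
    (s := fun r : ℝᵒᵈ => Ici (OrderDual.ofDual r)) (a := OrderDual.toDual y)
    (fun r _ => measurableSet_Ici.nullMeasurableSet)
    (fun i j _ hij => Ici_subset_Ici.2 hij) ⟨OrderDual.toDual (y - 1), by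
      rw [gt_iff_lt, OrderDual.toDual_lt_toDual]; linarith, measure_ne_top _ _⟩
  have h' : Tendsto (fun r => ν (Ici r)) (nhdsWithin y (Iio y))
      (nhds (ν (⋂ r < y, Ici r))) := h
  have e : (⋂ r < y, Ici r) = Ici y := by
    ext z
    simp only [mem_iInter, mem_Ici]
    exact ⟨fun h => le_of_forall_lt_imp_le_of_dense h, fun h r hr => hr.le.trans h⟩
  rw [e] at h'
  have key : ∀ r, ν (Iic r) = ν univ - ν (Ici r) := by
    intro r
    rw [← measure_congr (Ioi_ae_eq_Ici (μ := ν) (a := r)), ← compl_Iic,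
      measure_compl measurableSet_Iic (measure_ne_top _ _),
      ENNReal.sub_sub_cancel (measure_ne_top _ _) (measure_mono (subset_univ _))]
  simp only [key]
  exact ENNReal.Tendsto.sub tendsto_const_nhds h' (Or.inl (measure_ne_top _ _))

lemma aux_cont (ν : Measure ℝ) [IsFiniteMeasure ν] [NullSingletonClass ν] :
    Continuous (fun r => ν (Iic r)) := by
  rw [continuous_iff_continuousAt]
  intro y
  rw [continuousAt_iff_continuous_left'_right']
  exact ⟨aux_leftCont ν y, aux_rightCont ν y⟩

lemma aux_ivt (ρ : Measure ℝ) [IsFiniteMeasure ρ] [NullSingletonClass ρ] (c : ℝ≥0∞) (h0 : 0 < c)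
    (h1 : c < ρ univ) : ∃ x, ρ (Iic x) = c := by
  refine mem_range_of_exists_le_of_exists_ge (aux_cont ρ) ?_ ?_
  · have h : Tendsto (fun r => ρ (Iic r)) atBot (nhds (ρ (⋂ r : ℝ, Iic r))) :=
      tendsto_measure_iInter_atBot (fun i => measurableSet_Iic.nullMeasurableSet)
        (fun i j hij => Iic_subset_Iic.2 hij) ⟨0, measure_ne_top _ _⟩
    rw [iInter_Iic_eq_empty_iff.2 (by simp [not_bddBelow_univ]), measure_empty] at h
    exact ((h.eventually_lt_const h0).mono fun _ h => h.le).exists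
  · exact (((tendsto_measure_Iic_atTop ρ).eventually_const_lt h1).mono fun _ h => h.le).exists

lemma aux_unif_le (ρ : Measure ℝ) [IsFiniteMeasure ρ] [NullSingletonClass ρ] (c : ℝ≥0∞) :
    ρ {x | ρ (Iic x) ≤ c} ≤ c := by
  refine le_of_forall_gt_imp_ge_of_dense fun c' hc' => ?_
  rcases lt_or_ge c' (ρ univ) with h | h
  · obtain ⟨x, hx⟩ := aux_ivt ρ c' (bot_le.trans_lt hc') h
    rw [← hx]
    refine measure_mono fun z hz => ?_
    by_contra hzx
    have : ρ (Iic x) ≤ ρ (Iic z) := measure_mono (Iic_subset_Iic.2 (not_le.1 hzx).le)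
    have hz' : ρ (Iic z) ≤ c := hz
    exact absurd (this.trans hz') (by rw [hx]; exact not_le.2 hc')
  · exact (measure_mono (subset_univ _)).trans h

lemma aux_unif_ge (ρ : Measure ℝ) [IsFiniteMeasure ρ] [NullSingletonClass ρ] (c : ℝ≥0∞)
    (hc : c ≤ ρ univ) : c ≤ ρ {x | ρ (Iic x) < c} := by
  refine le_of_forall_lt_imp_le_of_dense fun c' hc' => ?_
  rcases eq_or_lt_of_le (bot_le : ⊥ ≤ c') with h | h
  · rw [← h]; exact bot_le
  · obtain ⟨x, hx⟩ := aux_ivt ρ c' h (hc'.trans_le hc)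
    rw [← hx]
    refine measure_mono fun z hz => ?_
    have : ρ (Iic z) ≤ ρ (Iic x) := measure_mono (Iic_subset_Iic.2 hz)
    exact (this.trans hx.le).trans_lt hc'

/-- Local transport, monotone case. -/
lemma local_inc (M1 M2 : Measure ℝ) [IsFiniteMeasure M1] [IsFiniteMeasure M2] [NullSingletonClass M1]
    [NullSingletonClass M2] (p q : ℝ) (hpq : p < q) (f g : ℝ → ℝ) (hf : MonotoneOn f (Icc p q))
    (hg : MonotoneOn g (Icc p q)) (hfg : ∀ x ∈ Icc p q, f x ≤ g x) :
    ∃ T : ℝ → ℝ, Measurable T ∧ MonotoneOn T (Icc p q) ∧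
      (∀ x ∈ Icc p q, f x ≤ T x ∧ T x ≤ g x) ∧ T p = f p ∧ T q = g q ∧
      ∀ A, MeasurableSet A → M1 (T ⁻¹' A ∩ Icc p q) + M2 (T ⁻¹' A ∩ Icc p q) =
        M1 (f ⁻¹' A ∩ Icc p q) + M2 (g ⁻¹' A ∩ Icc p q) := by
  classical
  set I := Icc p q with hI
  have hIm : MeasurableSet I := measurableSet_Icc
  have hpI : p ∈ I := ⟨le_rfl, hpq.le⟩
  have hqI : q ∈ I := ⟨hpq.le, le_rfl⟩
  set ρ : Measure ℝ := (M1 + M2).restrict I with hρ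
  have hfm : AEMeasurable f (M1.restrict I) := aemeasurable_restrict_of_monotoneOn hIm hf
  have hgm : AEMeasurable g (M2.restrict I) := aemeasurable_restrict_of_monotoneOn hIm hg
  set ν : Measure ℝ := (M1.restrict I).map f + (M2.restrict I).map g with hν
  have hνA : ∀ A, MeasurableSet A → ν A = M1 (f ⁻¹' A ∩ I) + M2 (g ⁻¹' A ∩ I) := by
    intro A hA
    rw [hν, Measure.add_apply, Measure.map_apply_of_aemeasurable hfm hA,
      Measure.map_apply_of_aemeasurable hgm hA, Measure.restrict_apply' hIm,
      Measure.restrict_apply' hIm]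
  have hρA : ∀ A, ρ A = M1 (A ∩ I) + M2 (A ∩ I) := by
    intro A
    rw [hρ, Measure.restrict_apply' hIm, Measure.add_apply]
  haveI : NullSingletonClass (M1 + M2) := ⟨fun x => by simp⟩
  have huniv : ν univ = ρ univ := by rw [hνA _ MeasurableSet.univ, hρA]; simp
  have hHG : ∀ x ∈ I, ρ (Iic x) ≤ ν (Iic (g x)) := by
    intro x hx
    rw [hρA, hνA _ measurableSet_Iic]
    refine add_le_add (measure_mono ?_) (measure_mono ?_)
    · rintro z ⟨hz, hzI⟩
      exact ⟨(hf hzI hx hz).trans (hfg x hx), hzI⟩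
    · rintro z ⟨hz, hzI⟩
      exact ⟨hg hzI hx hz, hzI⟩
  have hGH : ∀ x ∈ I, ∀ y < f x, ν (Iic y) ≤ ρ (Iic x) := by
    intro x hx y hy
    rw [hρA, hνA _ measurableSet_Iic]
    refine add_le_add (measure_mono ?_) (measure_mono ?_)
    · rintro z ⟨hz, hzI⟩
      refine ⟨?_, hzI⟩
      by_contra hzx
      have h1 : f z ≤ y := hz
      have := hf hx hzI (not_le.1 hzx).le
      linarith
    · rintro z ⟨hz, hzI⟩
      refine ⟨?_, hzI⟩
      by_contra hzx
      have h1 : g z ≤ y := hz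
      have := hg hx hzI (not_le.1 hzx).le
      have := hfg x hx
      linarith
  set S : ℝ → Set ℝ := fun x => {y | f x ≤ y ∧ ρ (Iic x) ≤ ν (Iic y)} with hS
  have hSb : ∀ x, BddBelow (S x) := fun x => ⟨f x, fun y hy => hy.1⟩
  have hSg : ∀ x ∈ I, g x ∈ S x := fun x hx => ⟨hfg x hx, hHG x hx⟩
  set T0 : ℝ → ℝ := fun x => sInf (S x) with hT0
  have hT0f : ∀ x ∈ I, f x ≤ T0 x := fun x hx => le_csInf ⟨_, hSg x hx⟩ fun y hy => hy.1
  have hT0g : ∀ x ∈ I, T0 x ≤ g x := fun x hx => csInf_le (hSb x) (hSg x hx)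
  have hT0mono : MonotoneOn T0 I := by
    intro x hx x' hx' hxx
    refine csInf_le_csInf (hSb x) ⟨_, hSg x' hx'⟩ ?_
    rintro y ⟨h1, h2⟩
    exact ⟨(hf hx hx' hxx).trans h1, (measure_mono (Iic_subset_Iic.2 hxx)).trans h2⟩
  have hT0p : T0 p = f p := by
    refine le_antisymm (csInf_le (hSb p) ⟨le_rfl, ?_⟩) (hT0f p hpI)
    have : ρ (Iic p) = 0 := by
      rw [hρA]
      have : Iic p ∩ I ⊆ {p} := fun z hz => le_antisymm hz.1 hz.2.1
      rw [measure_mono_null this (measure_singleton p), measure_mono_null this (measure_singleton p),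
        add_zero]
    rw [this]; exact bot_le
  have hT0le : ∀ x ∈ I, ∀ y, T0 x ≤ y → ρ (Iic x) ≤ ν (Iic y) := by
    intro x hx y hy
    refine ge_of_tendsto (aux_rightCont ν y) ?_
    filter_upwards [self_mem_nhdsWithin] with r hr
    obtain ⟨z, hz, hzr⟩ := exists_lt_of_csInf_lt ⟨_, hSg x hx⟩ (hy.trans_lt hr)
    exact hz.2.trans (measure_mono (Iic_subset_Iic.2 hzr.le))
  have hT0ge : ∀ x ∈ I, ∀ y, ρ (Iic x) < ν (Iic y) → T0 x ≤ y := by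
    intro x hx y hy
    refine csInf_le (hSb x) ⟨?_, hy.le⟩
    by_contra hlt
    exact absurd (hGH x hx y (not_le.1 hlt)) (not_le.2 hy)
  set T1 : ℝ → ℝ := fun x => if x = q then g q else T0 x with hT1
  have hT1mono : MonotoneOn T1 I := by
    intro x hx x' hx' hxx
    simp only [hT1]
    split_ifs with h1 h2 h2
    · exact le_rfl
    · exact absurd (le_antisymm hx'.2 (h1 ▸ hxx)) h2
    · exact (hT0g x hx).trans (hg hx hqI hx.2)
    · exact hT0mono hx hx' hxx
  obtain ⟨T, hTmono, hTeq⟩ := hT1mono.exists_monotone_extension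
    ⟨T1 p, by rintro _ ⟨x, hx, rfl⟩; exact hT1mono hpI hx hx.1⟩
    ⟨T1 q, by rintro _ ⟨x, hx, rfl⟩; exact hT1mono hx hqI hx.2⟩
  have hTq : T q = g q := by rw [← hTeq hqI]; simp [hT1]
  have hTx : ∀ x ∈ I, x ≠ q → T x = T0 x := by
    intro x hx hxq
    rw [← hTeq hx]; simp [hT1, hxq]
  have hmap : ρ.map T = ν := by
    haveI : IsFiniteMeasure (ρ.map T) := inferInstance
    refine Measure.ext_of_Iic _ _ fun y => ?_
    rw [Measure.map_apply hTmono.measurable measurableSet_Iic]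
    have hae : ∀ᵐ x ∂ρ, x ∈ I ∧ x ≠ q := by
      refine (ae_restrict_mem hIm).and ?_
      exact ae_restrict_of_ae (by simp [ae_iff])
    refine le_antisymm ?_ ?_
    · refine le_trans (measure_mono_ae ?_) (aux_unif_le ρ (ν (Iic y)))
      filter_upwards [hae] with x hx h
      have h' : T x ≤ y := h
      rw [hTx x hx.1 hx.2] at h'
      exact hT0le x hx.1 y h'
    · refine le_trans (aux_unif_ge ρ (ν (Iic y)) ?_) (measure_mono_ae ?_)
      · rw [← huniv]; exact measure_mono (subset_univ _)
      filter_upwards [hae] with x hx h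
      have h' := hT0ge x hx.1 y h
      rw [← hTx x hx.1 hx.2] at h'
      exact h'
  refine ⟨T, hTmono.measurable, hTmono.monotoneOn _, ?_, ?_, hTq, ?_⟩
  · intro x hx
    by_cases hxq : x = q
    · subst hxq
      rw [hTq]; exact ⟨hfg x hx, le_rfl⟩
    · rw [hTx x hx hxq]
      exact ⟨hT0f x hx, hT0g x hx⟩
  · rw [hTx p hpI hpq.ne, hT0p]
  · intro A hA
    rw [← hρA, ← hνA A hA, ← hmap, Measure.map_apply hTmono.measurable hA]

/-- Local transport, antitone case. -/
lemma local_dec (M1 M2 : Measure ℝ) [IsFiniteMeasure M1] [IsFiniteMeasure M2] [NullSingletonClass M1]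
    [NullSingletonClass M2] (p q : ℝ) (hpq : p < q) (f g : ℝ → ℝ) (hf : AntitoneOn f (Icc p q))
    (hg : AntitoneOn g (Icc p q)) (hfg : ∀ x ∈ Icc p q, f x ≤ g x) :
    ∃ T : ℝ → ℝ, Measurable T ∧ AntitoneOn T (Icc p q) ∧
      (∀ x ∈ Icc p q, f x ≤ T x ∧ T x ≤ g x) ∧ T p = g p ∧ T q = f q ∧
      ∀ A, MeasurableSet A → M1 (T ⁻¹' A ∩ Icc p q) + M2 (T ⁻¹' A ∩ Icc p q) =
        M1 (f ⁻¹' A ∩ Icc p q) + M2 (g ⁻¹' A ∩ Icc p q) := by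
  obtain ⟨T, h1, h2, h3, h4, h5, h6⟩ := local_inc M2 M1 p q hpq (fun x => - g x) (fun x => - f x)
    (fun x hx y hy h => neg_le_neg (hg hx hy h)) (fun x hx y hy h => neg_le_neg (hf hx hy h))
    (fun x hx => neg_le_neg (hfg x hx))
  refine ⟨fun x => - T x, h1.neg, fun x hx y hy h => neg_le_neg (h2 hx hy h), ?_, by simp [h4],
    by simp [h5], ?_⟩
  · intro x hx
    have := h3 x hx
    constructor <;> linarith [this.1, this.2]
  · intro A hA
    have := h6 ((fun x : ℝ => - x) ⁻¹' A) (measurable_neg hA)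
    simp only [← preimage_comp, Function.comp_def, neg_neg] at this
    rw [add_comm, add_comm (M1 (f ⁻¹' A ∩ Icc p q))]
    exact this

lemma aux_noAtoms (μ : Measure ℝ) [IsProbabilityMeasure μ] (hs : μ (Icc (0:ℝ) 1) = 1)
    (hc : Continuous (fun x => (μ (Icc 0 x)).toReal)) : NullSingletonClass μ := by
  refine ⟨fun x => ?_⟩
  rcases lt_or_ge x 0 with hx | hx
  · have h0 : μ (Icc (0:ℝ) 1)ᶜ = 0 := by
      rw [prob_compl_eq_zero_iff measurableSet_Icc, hs]
    exact measure_mono_null (by rintro _ rfl h; exact absurd h.1 (not_le.2 hx)) h0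
  · have key : ∀ y < x, (μ {x}).toReal ≤ (μ (Icc 0 x)).toReal - (μ (Icc 0 y)).toReal := by
      intro y hy
      have hd : Disjoint {x} (Icc 0 y) := by
        rw [disjoint_singleton_left]; exact fun h => absurd h.2 (not_le.2 hy)
      have h1 : μ {x} + μ (Icc 0 y) ≤ μ (Icc 0 x) := by
        rw [← measure_union hd measurableSet_Icc]
        refine measure_mono ?_
        rintro z (rfl | hz)
        · exact ⟨hx, le_rfl⟩
        · exact ⟨hz.1, hz.2.trans hy.le⟩
      have h2 := ENNReal.toReal_mono (measure_ne_top _ _) h1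
      rw [ENNReal.toReal_add (measure_ne_top _ _) (measure_ne_top _ _)] at h2
      linarith
    have ht : Tendsto (fun y => (μ (Icc 0 x)).toReal - (μ (Icc 0 y)).toReal)
        (nhdsWithin x (Iio x)) (nhds ((μ (Icc 0 x)).toReal - (μ (Icc 0 x)).toReal)) :=
      tendsto_const_nhds.sub (hc.continuousAt.tendsto.mono_left nhdsWithin_le_nhds)
    rw [sub_self] at ht
    have h0 : (μ {x}).toReal ≤ 0 := by
      refine ge_of_tendsto ht ?_
      filter_upwards [self_mem_nhdsWithin] with y hy using key y hy
    have := le_antisymm h0 ENNReal.toReal_nonneg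
    rcases (ENNReal.toReal_eq_zero_iff _).1 this with h | h
    · exact h
    · exact absurd h (measure_ne_top _ _)

/-- Split a measure along `Ico ∪ Icc`. -/
lemma aux_split (M : Measure ℝ) [NullSingletonClass M] (u v w : ℝ) (huv : u ≤ v) (hvw : v ≤ w)
    (X : Set ℝ) : M (X ∩ Icc u w) = M (X ∩ Icc u v) + M (X ∩ Icc v w) := by
  rw [← measure_inter_add_diff (X ∩ Icc u w) (measurableSet_Iic (a := v))]
  congr 1
  · congr 1
    ext z
    simp only [mem_inter_iff, mem_Icc, mem_Iic]
    constructor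
    · rintro ⟨⟨h1, h2, h3⟩, h4⟩; exact ⟨h1, h2, h4⟩
    · rintro ⟨h1, h2, h3⟩; exact ⟨⟨h1, h2, h3.trans hvw⟩, h3⟩
  · have : (X ∩ Icc u w) \ Iic v = X ∩ Ioc v w := by
      ext z
      simp only [mem_inter_iff, mem_Icc, mem_Iic, mem_diff, mem_Ioc, not_le]
      constructor
      · rintro ⟨⟨h1, h2, h3⟩, h4⟩; exact ⟨h1, h4, h3⟩
      · rintro ⟨h1, h2, h3⟩; exact ⟨⟨h1, huv.trans h2.le, h3⟩, h2⟩
    rw [this]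
    exact measure_congr ((ae_eq_refl X).inter Ioc_ae_eq_Icc)

lemma aux_run_mono (a : ℕ → ℝ) (f : ℝ → ℝ) (k : ℕ) : ∀ d : ℕ,
    (∀ j, k ≤ j → j < k + d → a j ≤ a (j + 1)) →
    (∀ j, k ≤ j → j < k + d → MonotoneOn f (Icc (a j) (a (j + 1)))) →
    a k ≤ a (k + d) ∧ MonotoneOn f (Icc (a k) (a (k + d))) := by
  intro d
  induction d with
  | zero => intro _ _; simp
  | succ d ih =>
    intro h1 h2
    obtain ⟨i1, i2⟩ := ih (fun j hj hj' => h1 j hj (by omega)) (fun j hj hj' => h2 j hj (by omega))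
    have e1 := h1 (k + d) (by omega) (by omega)
    have e2 := h2 (k + d) (by omega) (by omega)
    refine ⟨i1.trans e1, ?_⟩
    have := i2.union_right e2 (isGreatest_Icc i1) (isLeast_Icc e1)
    rwa [Icc_union_Icc_eq_Icc i1 e1] at this

lemma aux_run_anti (a : ℕ → ℝ) (f : ℝ → ℝ) (k d : ℕ)
    (h1 : ∀ j, k ≤ j → j < k + d → a j ≤ a (j + 1))
    (h2 : ∀ j, k ≤ j → j < k + d → AntitoneOn f (Icc (a j) (a (j + 1)))) :
    AntitoneOn f (Icc (a k) (a (k + d))) := by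
  have := (aux_run_mono a (fun x => - f x) k d h1
    (fun j hj hj' x hx y hy h => neg_le_neg (h2 j hj hj' hx hy h))).2
  intro x hx y hy h
  exact neg_le_neg_iff.1 (this hx hy h)

/-- The last index at which the orientation changes before `n`. -/
lemma aux_run_start (o : ℕ → Prop) (n : ℕ) : ∃ k ≤ n,
    (∀ j, k ≤ j → j < n + 1 → (o j ↔ o n)) ∧ (k = 0 ∨ ¬ (o (k - 1) ↔ o n)) := by
  induction n with
  | zero => exact ⟨0, le_rfl, fun j _ h => by rw [show j = 0 by omega], Or.inl rfl⟩
  | succ n ih =>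
    by_cases h : o n ↔ o (n + 1)
    · obtain ⟨k, hk, h1, h2⟩ := ih
      refine ⟨k, by omega, fun j hj hj' => ?_, by rwa [h] at h2⟩
      rcases Nat.lt_or_ge j (n + 1) with h3 | h3
      · rw [h1 j hj h3, h]
      · rw [show j = n + 1 by omega]
    · exact ⟨n + 1, le_rfl, fun j hj hj' => by rw [show j = n + 1 by omega], Or.inr (by simpa using h)⟩

open Classical in
lemma global_selector (M1 M2 : Measure ℝ) [IsFiniteMeasure M1] [IsFiniteMeasure M2]
    [NullSingletonClass M1] [NullSingletonClass M2] (m : ℕ) (a : ℕ → ℝ)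
    (hmono : ∀ i < m, a i < a (i + 1)) (f g : ℝ → ℝ)
    (hle : ∀ x ∈ Icc (a 0) (a m), f x ≤ g x) (o : ℕ → Prop)
    (hinc : ∀ j < m, o j → MonotoneOn f (Icc (a j) (a (j + 1)))
      ∧ MonotoneOn g (Icc (a j) (a (j + 1))))
    (hdec : ∀ j < m, ¬ o j → AntitoneOn f (Icc (a j) (a (j + 1)))
      ∧ AntitoneOn g (Icc (a j) (a (j + 1)))) (n : ℕ) :
    n ≤ m → ∃ T : ℝ → ℝ, Measurable T ∧ (∀ x ∈ Icc (a 0) (a n), f x ≤ T x ∧ T x ≤ g x) ∧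
      (∀ j < n, MonotoneOn T (Icc (a j) (a (j + 1))) ∨ AntitoneOn T (Icc (a j) (a (j + 1)))) ∧
      (0 < n → T (a n) = if o (n - 1) then g (a n) else f (a n)) ∧
      ∀ A, MeasurableSet A → M1 (T ⁻¹' A ∩ Icc (a 0) (a n)) + M2 (T ⁻¹' A ∩ Icc (a 0) (a n)) =
        M1 (f ⁻¹' A ∩ Icc (a 0) (a n)) + M2 (g ⁻¹' A ∩ Icc (a 0) (a n)) := by
  have amono : ∀ i j, i ≤ j → j ≤ m → a i ≤ a j := by
    intro i j hij
    induction j, hij using Nat.le_induction with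
    | base => intro _; exact le_rfl
    | succ j hj ih => intro h; exact (ih (by omega)).trans (hmono j (by omega)).le
  induction n using Nat.strong_induction_on with
  | _ n IH =>
  intro hn
  rcases n with _ | n
  · refine ⟨fun _ => f (a 0), measurable_const, ?_, by simp, by simp, ?_⟩
    · intro x hx
      have : x = a 0 := le_antisymm hx.2 hx.1
      subst this
      exact ⟨le_rfl, hle _ ⟨le_rfl, amono 0 m (by omega) le_rfl⟩⟩
    · intro A _
      have h1 : ∀ X : Set ℝ, M1 (X ∩ Icc (a 0) (a 0)) = 0 := fun X =>
        measure_mono_null inter_subset_right (by simp)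
      have h2 : ∀ X : Set ℝ, M2 (X ∩ Icc (a 0) (a 0)) = 0 := fun X =>
        measure_mono_null inter_subset_right (by simp)
      simp only [h1, h2]
  obtain ⟨k, hk, hrun, hstart⟩ := aux_run_start o n
  obtain ⟨T, hTm, hTb, hTmono, hTe, hTA⟩ := IH k (by omega) (by omega)
  obtain ⟨d, hd⟩ : ∃ d, n + 1 = k + d := ⟨n + 1 - k, by omega⟩
  have ha1 : ∀ j, k ≤ j → j < k + d → a j ≤ a (j + 1) := fun j _ h => (hmono j (by omega)).le
  have hkn : a k < a (n + 1) := (amono k n hk (by omega)).trans_lt (hmono n (by omega))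
  have h0k : a 0 ≤ a k := amono 0 k (by omega) (by omega)
  have hle' : ∀ x ∈ Icc (a k) (a (n + 1)), f x ≤ g x := fun x hx =>
    hle x ⟨h0k.trans hx.1, hx.2.trans (amono _ _ hn le_rfl)⟩
  -- the piece on the last run
  obtain ⟨S, hSm, hSmono, hSb, hSp, hSq, hSA⟩ : ∃ S : ℝ → ℝ, Measurable S ∧
      (MonotoneOn S (Icc (a k) (a (n + 1))) ∨ AntitoneOn S (Icc (a k) (a (n + 1)))) ∧
      (∀ x ∈ Icc (a k) (a (n + 1)), f x ≤ S x ∧ S x ≤ g x) ∧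
      (S (a k) = if o n then f (a k) else g (a k)) ∧
      (S (a (n + 1)) = if o n then g (a (n + 1)) else f (a (n + 1))) ∧
      ∀ A, MeasurableSet A → M1 (S ⁻¹' A ∩ Icc (a k) (a (n + 1))) +
        M2 (S ⁻¹' A ∩ Icc (a k) (a (n + 1))) =
        M1 (f ⁻¹' A ∩ Icc (a k) (a (n + 1))) + M2 (g ⁻¹' A ∩ Icc (a k) (a (n + 1))) := by
    by_cases hon : o n
    · have hi : ∀ j, k ≤ j → j < k + d → o j := fun j h h' => (hrun j h (by omega)).2 hon
      have hf := (aux_run_mono a f k d ha1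
        (fun j h h' => (hinc j (by omega) (hi j h h')).1)).2
      have hg := (aux_run_mono a g k d ha1
        (fun j h h' => (hinc j (by omega) (hi j h h')).2)).2
      rw [← hd] at hf hg
      obtain ⟨S, h1, h2, h3, h4, h5, h6⟩ := local_inc M1 M2 _ _ hkn f g hf hg hle'
      exact ⟨S, h1, Or.inl h2, h3, by simp [hon, h4], by simp [hon, h5], h6⟩
    · have hi : ∀ j, k ≤ j → j < k + d → ¬ o j := fun j h h' h'' =>
        hon ((hrun j h (by omega)).1 h'')
      have hf := aux_run_anti a f k d ha1
        (fun j h h' => (hdec j (by omega) (hi j h h')).1)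
      have hg := aux_run_anti a g k d ha1
        (fun j h h' => (hdec j (by omega) (hi j h h')).2)
      rw [← hd] at hf hg
      obtain ⟨S, h1, h2, h3, h4, h5, h6⟩ := local_dec M1 M2 _ _ hkn f g hf hg hle'
      exact ⟨S, h1, Or.inr h2, h3, by simp [hon, h4], by simp [hon, h5], h6⟩
  set U : ℝ → ℝ := (Iio (a k)).piecewise T S with hU
  have hUS : EqOn U S (Icc (a k) (a (n + 1))) := fun x hx =>
    piecewise_eq_of_notMem _ _ _ (by simpa using hx.1)
  have hUT' : ∀ x < a k, U x = T x := fun x hx => piecewise_eq_of_mem _ _ _ hx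
  have hUT : 0 < k → EqOn U T (Icc (a 0) (a k)) := by
    intro hk0 x hx
    rcases lt_or_eq_of_le hx.2 with h | h
    · exact hUT' x h
    · subst h
      rw [hUS ⟨le_rfl, hkn.le⟩, hSp, hTe hk0]
      have := hstart.resolve_left (by omega)
      by_cases h1 : o n <;> by_cases h2 : o (k - 1) <;> simp_all
  refine ⟨U, hTm.piecewise measurableSet_Iio hSm, ?_, ?_, ?_, ?_⟩
  · intro x hx
    rcases lt_or_ge x (a k) with h | h
    · rw [hUT' x h]; exact hTb x ⟨hx.1, h.le⟩
    · rw [hUS ⟨h, hx.2⟩]; exact hSb x ⟨h, hx.2⟩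
  · intro j hj
    rcases lt_or_ge j k with h | h
    · have hsub : Icc (a j) (a (j + 1)) ⊆ Icc (a 0) (a k) :=
        Icc_subset_Icc (amono _ _ (by omega) (by omega)) (amono _ _ (by omega) (by omega))
      have he := ((hUT (by omega)).mono hsub).symm
      exact (hTmono j h).imp (fun h => h.congr he) (fun h => h.congr he)
    · have hsub : Icc (a j) (a (j + 1)) ⊆ Icc (a k) (a (n + 1)) :=
        Icc_subset_Icc (amono _ _ (by omega) (by omega)) (amono _ _ (by omega) (by omega))
      have he := (hUS.mono hsub).symm
      exact hSmono.imp (fun h => (h.mono hsub).congr he) (fun h => (h.mono hsub).congr he)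
  · intro _
    rw [hUS ⟨hkn.le, le_rfl⟩, hSq]
    simp
  · intro A hA
    have hS' : U ⁻¹' A ∩ Icc (a k) (a (n + 1)) = S ⁻¹' A ∩ Icc (a k) (a (n + 1)) := by
      ext z
      simp only [mem_inter_iff, mem_preimage]
      exact and_congr_left fun hz => by rw [hUS hz]
    have hT' : ∀ M : Measure ℝ, NullSingletonClass M →
        M (U ⁻¹' A ∩ Icc (a 0) (a k)) = M (T ⁻¹' A ∩ Icc (a 0) (a k)) := by
      intro M _
      refine measure_congr ?_
      have : ∀ᵐ x ∂M, x ≠ a k := by simp [ae_iff]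
      filter_upwards [this] with z hz
      refine propext (and_congr_left fun hz' => ?_)
      change U z ∈ A ↔ T z ∈ A
      rw [hUT' z (lt_of_le_of_ne hz'.2 hz)]
    have e1 := hTA A hA
    have e2 := hSA A hA
    rw [aux_split M1 _ _ _ h0k hkn.le (U ⁻¹' A), aux_split M2 _ _ _ h0k hkn.le (U ⁻¹' A),
      aux_split M1 _ _ _ h0k hkn.le (f ⁻¹' A), aux_split M2 _ _ _ h0k hkn.le (g ⁻¹' A), hS',
      hT' M1 inferInstance, hT' M2 inferInstance, add_add_add_comm, e1, e2, add_add_add_comm]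



/-- Given boundary maps `τ1 ≤ τ2` on `[0,1]`, piecewise `C¹` and strictly
monotone with the same orientation on each interval of a common partition
`0 = a 0 < a 1 < ⋯ < a m = 1`, if `τ_k` preserves a Borel probability measure `μ_k` with
continuous distribution function, then for every `l ∈ (0,1)` there is a measurable selector
`T` between `τ1` and `τ2`, monotone on each partition interval, preserving
`μ = l·μ1 + (1-l)·μ2`. -/
theorem selector_for_convex_combination_of_invariant_measures
    (m : ℕ) (hm : 0 < m) (a : ℕ → ℝ) (ha0 : a 0 = 0) (ham : a m = 1)
    (hmono : ∀ i < m, a i < a (i + 1))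
    (τ1 τ2 : ℝ → ℝ)
    (hmap1 : MapsTo τ1 (Set.Icc (0:ℝ) 1) (Set.Icc (0:ℝ) 1))
    (hmap2 : MapsTo τ2 (Set.Icc (0:ℝ) 1) (Set.Icc (0:ℝ) 1))
    (hle : ∀ x ∈ Set.Icc (0:ℝ) 1, τ1 x ≤ τ2 x)
    (hC1 : ∀ j < m, ContDiffOn ℝ 1 τ1 (Set.Icc (a j) (a (j + 1)))
      ∧ ContDiffOn ℝ 1 τ2 (Set.Icc (a j) (a (j + 1))))
    (hsamemono : ∀ j < m,
        (StrictMonoOn τ1 (Set.Icc (a j) (a (j + 1)))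
          ∧ StrictMonoOn τ2 (Set.Icc (a j) (a (j + 1))))
      ∨ (StrictAntiOn τ1 (Set.Icc (a j) (a (j + 1)))
          ∧ StrictAntiOn τ2 (Set.Icc (a j) (a (j + 1)))))
    (μ1 μ2 : Measure ℝ) [IsProbabilityMeasure μ1] [IsProbabilityMeasure μ2]
    (hs1 : μ1 (Set.Icc (0:ℝ) 1) = 1) (hs2 : μ2 (Set.Icc (0:ℝ) 1) = 1)
    (hinv1 : ∀ A : Set ℝ, MeasurableSet A → μ1 (τ1 ⁻¹' A) = μ1 A)
    (hinv2 : ∀ A : Set ℝ, MeasurableSet A → μ2 (τ2 ⁻¹' A) = μ2 A)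
    (hF1cont : Continuous (fun x => (μ1 (Set.Icc 0 x)).toReal))
    (hF2cont : Continuous (fun x => (μ2 (Set.Icc 0 x)).toReal))
    (l : ℝ) (hl : l ∈ Set.Ioo (0:ℝ) 1) :
    ∃ T : ℝ → ℝ, Measurable T ∧
      MapsTo T (Set.Icc (0:ℝ) 1) (Set.Icc (0:ℝ) 1) ∧
      (∀ x ∈ Set.Icc (0:ℝ) 1, τ1 x ≤ T x ∧ T x ≤ τ2 x) ∧
      (∀ j < m, MonotoneOn T (Set.Icc (a j) (a (j + 1)))
        ∨ AntitoneOn T (Set.Icc (a j) (a (j + 1)))) ∧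
      (∀ A : Set ℝ, MeasurableSet A →
        (ENNReal.ofReal l • μ1 + ENNReal.ofReal (1 - l) • μ2) (T ⁻¹' A)
          = (ENNReal.ofReal l • μ1 + ENNReal.ofReal (1 - l) • μ2) A) := by
  classical
  haveI := aux_noAtoms μ1 hs1 hF1cont
  haveI := aux_noAtoms μ2 hs2 hF2cont
  set M1 : Measure ℝ := ENNReal.ofReal l • μ1 with hM1
  set M2 : Measure ℝ := ENNReal.ofReal (1 - l) • μ2 with hM2
  haveI : IsFiniteMeasure M1 := Measure.smul_finite μ1 ENNReal.ofReal_ne_top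
  haveI : IsFiniteMeasure M2 := Measure.smul_finite μ2 ENNReal.ofReal_ne_top
  haveI : NullSingletonClass M1 := ⟨fun x => by simp [hM1]⟩
  haveI : NullSingletonClass M2 := ⟨fun x => by simp [hM2]⟩
  have hz1 : M1 (Icc (0:ℝ) 1)ᶜ = 0 := by
    have : μ1 (Icc (0:ℝ) 1)ᶜ = 0 := by rw [prob_compl_eq_zero_iff measurableSet_Icc, hs1]
    simp [hM1, this]
  have hz2 : M2 (Icc (0:ℝ) 1)ᶜ = 0 := by
    have : μ2 (Icc (0:ℝ) 1)ᶜ = 0 := by rw [prob_compl_eq_zero_iff measurableSet_Icc, hs2]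
    simp [hM2, this]
  obtain ⟨T, h1, h2, h3, -, h5⟩ := global_selector M1 M2 m a hmono τ1 τ2
    (by rw [ha0, ham]; exact hle)
    (fun j => StrictMonoOn τ1 (Icc (a j) (a (j + 1))) ∧ StrictMonoOn τ2 (Icc (a j) (a (j + 1))))
    (fun j _ h => ⟨h.1.monotoneOn, h.2.monotoneOn⟩)
    (fun j hj h => by
      have := (hsamemono j hj).resolve_left h
      exact ⟨this.1.antitoneOn, this.2.antitoneOn⟩) m le_rfl
  rw [ha0, ham] at h2 h5
  refine ⟨T, h1, ?_, h2, h3, ?_⟩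
  · intro x hx
    exact ⟨(hmap1 hx).1.trans (h2 x hx).1, (h2 x hx).2.trans (hmap2 hx).2⟩
  · intro A hA
    have := h5 A hA
    rw [measure_inter_conull hz1, measure_inter_conull hz2, measure_inter_conull hz1,
      measure_inter_conull hz2] at this
    rw [Measure.add_apply, Measure.add_apply, this]
    simp only [hM1, hM2, Measure.smul_apply, hinv1 A hA, hinv2 A hA]
end

section
/- Define τ1, τ2 : [0,1] → [0,1] by τ1(x) = 3x² + x/2 and τ2(x) = −3x² + (7/2)x for x ∈ [0, 1/2], and τ1(x) = 3(x − 1/2)² + (x − 1/2)/2, τ2(x) = −3(x − 1/2)² + (7/2)(x − 1/2) for x ∈ (1/2, 1]. Define p : [0,1] → [0,1] by p(x) = (3/2)x + 1/8 for x ∈ [0, 1/2] and p(x) = (3/2)(x − 1/2) + 1/8 for x ∈ (1/2, 1]. Then Lebesgue measure λ_Leb on [0,1] is invariant under the position-dependent random map R = {τ1, τ2; p, 1−p}: for every Borel set A ⊆ [0,1], λ_Leb(A) = ∫₀¹ (p(x)·1_A(τ1(x)) + (1−p(x))·1_A(τ2(x))) dx. -/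
open MeasureTheory Set Filter
open scoped ENNReal

/-- Lebesgue measure restricted to the unit interval `[0,1]`. -/
noncomputable def leb01 : Measure ℝ := volume.restrict (Set.Icc (0:ℝ) 1)

/-- Invariance of a measure `μ` under the position dependent random map
`R = {τ1, τ2; p, 1-p}`. -/
def RMInvariant (τ1 τ2 p : ℝ → ℝ) (μ : Measure ℝ) : Prop :=
  ∀ A : Set ℝ, MeasurableSet A →
    μ A = ∫⁻ x, (ENNReal.ofReal (p x) * A.indicator (fun _ => (1:ℝ≥0∞)) (τ1 x)
      + ENNReal.ofReal (1 - p x) * A.indicator (fun _ => (1:ℝ≥0∞)) (τ2 x)) ∂μ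

/-- Lower boundary map of Section 5 of the paper (`b₁ = 1/2`). -/
noncomputable def tauSing1 : ℝ → ℝ := fun x =>
  if x ≤ 1/2 then 3*x^2 + x/2 else 3*(x - 1/2)^2 + (x - 1/2)/2

/-- Upper boundary map of Section 5 of the paper (`b₂ = 7/2`). -/
noncomputable def tauSing2 : ℝ → ℝ := fun x =>
  if x ≤ 1/2 then -3*x^2 + (7/2)*x else -3*(x - 1/2)^2 + (7/2)*(x - 1/2)

/-- The probability function of Section 5 of the paper. -/
noncomputable def pSing : ℝ → ℝ := fun x =>
  if x ≤ 1/2 then (3/2)*x + 1/8 else (3/2)*(x - 1/2) + 1/8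

lemma piece_aux (f f' : ℝ → ℝ) (a b : ℝ) (hab : a ≤ b)
    (hf : ∀ x, HasDerivAt f (f' x) x) (hpos : ∀ x ∈ Icc a b, 0 < f' x)
    (ha : f a = 0) (hb : f b = 1) (A : Set ℝ) (hA : MeasurableSet A) :
    ∫⁻ x in Ioc a b, ENNReal.ofReal (f' x / 4) * A.indicator (fun _ => (1:ℝ≥0∞)) (f x)
      = ENNReal.ofReal (1/4) * leb01 A := by
  have hcont : ContinuousOn f (Icc a b) := fun x _ => (hf x).continuousAt.continuousWithinAt
  have hmono : StrictMonoOn f (Icc a b) := by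
    apply strictMonoOn_of_deriv_pos (convex_Icc a b) hcont
    intro x hx
    rw [(hf x).deriv]
    exact hpos x (interior_subset hx)
  have himg : f '' Icc a b = Icc 0 1 := by
    apply Subset.antisymm
    · rintro _ ⟨x, hx, rfl⟩
      constructor
      · rw [← ha]; exact hmono.monotoneOn (left_mem_Icc.2 hab) hx hx.1
      · rw [← hb]; exact hmono.monotoneOn hx (right_mem_Icc.2 hab) hx.2
    · have := intermediate_value_Icc hab hcont
      rwa [ha, hb] at this
  have key := lintegral_image_eq_lintegral_abs_deriv_mul (measurableSet_Icc (a := a) (b := b))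
    (fun x _ => (hf x).hasDerivWithinAt) hmono.injOn (A.indicator (fun _ => (1:ℝ≥0∞)))
  rw [himg] at key
  have h1 : leb01 A = ∫⁻ x in Icc (0:ℝ) 1, A.indicator (fun _ => (1:ℝ≥0∞)) x := by
    rw [lintegral_indicator_const hA, one_mul]; rfl
  rw [h1, key, ← lintegral_const_mul' _ _ ENNReal.ofReal_ne_top,
    Measure.restrict_congr_set (Ioc_ae_eq_Icc (μ := volume) (a := a) (b := b))]
  apply setLIntegral_congr_fun measurableSet_Icc
  intro x hx
  have h := hpos x hx
  simp only []
  rw [← mul_assoc, ← ENNReal.ofReal_mul (by norm_num), abs_of_pos h]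
  congr 2
  ring

lemma hasDeriv_quad (c d e x : ℝ) :
    HasDerivAt (fun x : ℝ => c * (x - e)^2 + d * (x - e)) (2 * c * (x - e) + d) x := by
  have h : HasDerivAt (fun x : ℝ => x - e) 1 x := (hasDerivAt_id x).sub_const e
  have := ((h.pow 2).const_mul c).add (h.const_mul d)
  refine this.congr_deriv ?_
  push_cast
  ring

lemma half_aux (e : ℝ) (A : Set ℝ) (hA : MeasurableSet A) (τ1 τ2 p : ℝ → ℝ)
    (h1 : ∀ x ∈ Ioc e (e + 1/2), τ1 x = 3 * (x - e)^2 + 1/2 * (x - e))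
    (h2 : ∀ x ∈ Ioc e (e + 1/2), τ2 x = -3 * (x - e)^2 + 7/2 * (x - e))
    (hp : ∀ x ∈ Ioc e (e + 1/2), p x = 3/2 * (x - e) + 1/8) :
    ∫⁻ x in Ioc e (e + 1/2),
      (ENNReal.ofReal (p x) * A.indicator (fun _ => (1:ℝ≥0∞)) (τ1 x)
      + ENNReal.ofReal (1 - p x) * A.indicator (fun _ => (1:ℝ≥0∞)) (τ2 x))
      = ENNReal.ofReal (1/2) * leb01 A := by
  have k1 := piece_aux _ _ e (e + 1/2) (by linarith) (hasDeriv_quad 3 (1/2) e)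
    (fun x hx => by have := hx.1; linarith) (by ring) (by ring) A hA
  have k2 := piece_aux _ _ e (e + 1/2) (by linarith) (hasDeriv_quad (-3) (7/2) e)
    (fun x hx => by have := hx.2; linarith) (by ring) (by ring) A hA
  have hs : ENNReal.ofReal (1/2) = ENNReal.ofReal (1/4) + ENNReal.ofReal (1/4) := by
    rw [← ENNReal.ofReal_add (by norm_num) (by norm_num)]; norm_num
  rw [hs, add_mul]
  nth_rewrite 1 [← k1]
  rw [← k2, ← lintegral_add_left]
  · apply setLIntegral_congr_fun measurableSet_Ioc
    intro x hx
    simp only []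
    rw [h1 x hx, h2 x hx, hp x hx]
    congr 3 <;> ring_nf
  · apply Measurable.mul
    · fun_prop
    · exact (measurable_const.indicator hA).comp (by fun_prop)

/-- (Section 5 of the paper: singular + singular = Lebesgue.)  Lebesgue
measure on `[0,1]` is invariant under the position dependent random map
`R = {τ1, τ2; p, 1−p}` built from the two quadratic boundary maps, even though neither
boundary map has an absolutely continuous invariant measure. -/
theorem singular_plus_singular_equals_lebesgue :
    RMInvariant tauSing1 tauSing2 pSing leb01 := by
  intro A hA
  have k1 := half_aux 0 A hA tauSing1 tauSing2 pSing
    (fun x hx => by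
      have : x ≤ 1/2 := by linarith [hx.2]
      simp only [tauSing1, if_pos this]; ring)
    (fun x hx => by
      have : x ≤ 1/2 := by linarith [hx.2]
      simp only [tauSing2, if_pos this]; ring)
    (fun x hx => by
      have : x ≤ 1/2 := by linarith [hx.2]
      simp only [pSing, if_pos this]; ring)
  have k2 := half_aux (1/2) A hA tauSing1 tauSing2 pSing
    (fun x hx => by
      simp only [tauSing1, if_neg (not_le.2 hx.1)]; ring)
    (fun x hx => by
      simp only [tauSing2, if_neg (not_le.2 hx.1)])
    (fun x hx => by
      simp only [pSing, if_neg (not_le.2 hx.1)])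
  rw [zero_add] at k1
  rw [show (1/2 + 1/2 : ℝ) = 1 by norm_num] at k2
  have hs : ENNReal.ofReal (1/2) + ENNReal.ofReal (1/2) = 1 := by
    rw [← ENNReal.ofReal_add (by norm_num) (by norm_num)]; norm_num
  have hl : leb01 = volume.restrict (Ioc (0:ℝ) (1/2) ∪ Ioc (1/2) 1) := by
    rw [Ioc_union_Ioc_eq_Ioc (by norm_num) (by norm_num)]
    exact (Measure.restrict_congr_set Ioc_ae_eq_Icc).symm
  conv_rhs => rw [hl]
  rw [lintegral_union measurableSet_Ioc (Ioc_disjoint_Ioc_of_le le_rfl), k1, k2, ← add_mul, hs,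
    one_mul]
end
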